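/- Let φ = e¹∧e²∧e⁷ + e³∧e⁴∧e⁷ + e⁵∧e⁶∧e⁷ + e¹∧e³∧e⁵ − e¹∧e⁴∧e⁶ − e²∧e³∧e⁶ − e²∧e⁴∧e⁵ be the canonical alternating 3-form on ℝ⁷, and for a linear map A : ℝ⁷ → ℝ⁷ define θ(A)φ to be the alternating 3-form (x,y,z) ↦ −φ(Ax,y,z) − φ(x,Ay,z) − φ(x,y,Az). Then the linear map End(ℝ⁷) → Λ³(ℝ⁷)*, A ↦ θ(A)φ, is surjective: every alternating 3-form ψ on ℝ⁷ equals θ(A)φ for some A. -/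

import Mathlib

/-- `wedge3 i j k x y z` is the value `(eⁱ ∧ eʲ ∧ eᵏ)(x,y,z)` of a basic alternating 3-form. -/
noncomputable def wedge3 (i j k : Fin 7) (x y z : Fin 7 → ℝ) : ℝ :=
  x i * (y j * z k - y k * z j) - x j * (y i * z k - y k * z i) + x k * (y i * z j - y j * z i)

/-- The canonical positive 3-form
`φ = e¹²⁷ + e³⁴⁷ + e⁵⁶⁷ + e¹³⁵ − e¹⁴⁶ − e²³⁶ − e²⁴⁵` on `ℝ⁷`
(indices shifted down by one). -/
noncomputable def phi3 (x y z : Fin 7 → ℝ) : ℝ :=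
  wedge3 0 1 6 x y z + wedge3 2 3 6 x y z + wedge3 4 5 6 x y z + wedge3 0 2 4 x y z
    - wedge3 0 3 5 x y z - wedge3 1 2 5 x y z - wedge3 1 3 4 x y z

/-- The alternating 3-form `θ(A)φ`. -/
noncomputable def thetaPhi (A : Module.End ℝ (Fin 7 → ℝ)) :
    AlternatingMap ℝ (Fin 7 → ℝ) ℝ (Fin 3) where
  toFun v := -phi3 (A (v 0)) (v 1) (v 2) - phi3 (v 0) (A (v 1)) (v 2) - phi3 (v 0) (v 1) (A (v 2))
  map_update_add' := by
    intro inst v i x y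
    obtain rfl : inst = instDecidableEqFin 3 := Subsingleton.elim _ _
    fin_cases i <;> simp [phi3, wedge3, Function.update] <;> ring
  map_update_smul' := by
    intro inst v i r x
    obtain rfl : inst = instDecidableEqFin 3 := Subsingleton.elim _ _
    fin_cases i <;> simp [phi3, wedge3, Function.update] <;> ring
  map_eq_zero_of_eq' v i j h hij := by
    fin_cases i <;> fin_cases j <;> simp at h hij ⊢ <;> rw [h] <;> simp only [phi3, wedge3] <;> ring

/-- Two alternating maps agreeing on strictly increasing families of basis vectors are equal. -/
theorem AlternatingMap.ext_basis_strictMono {R M N ι : Type*} [CommRing R] [AddCommGroup M]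
    [Module R M] [AddCommGroup N] [Module R N] [LinearOrder ι] {n : ℕ}
    {f g : AlternatingMap R M N (Fin n)} (b : Module.Basis ι R M)
    (h : ∀ v : Fin n → ι, StrictMono v → f (b ∘ v) = g (b ∘ v)) : f = g := by
  refine Module.Basis.ext_alternating b fun v hv => ?_
  have hs := h (v ∘ Tuple.sort v)
    ((Tuple.monotone_sort v).strictMono_of_injective (hv.comp (Tuple.sort v).injective))
  rw [← Function.comp_assoc, f.map_perm, g.map_perm] at hs
  exact smul_left_cancel _ hs

/-- A matrix `A` with `θ(A)φ = ψ`, where `c i j k` is the value of `ψ` on the standard basis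
vectors with indices `i < j < k`. -/
noncomputable def thetaPhiPreimage (c : Fin 7 → Fin 7 → Fin 7 → ℝ) : Matrix (Fin 7) (Fin 7) ℝ :=
  !![(-2 * c 0 1 6 - 2 * c 0 2 4 + 2 * c 0 3 5 - c 1 2 5 - c 1 3 4 + c 2 3 6 + c 4 5 6) / 6,
    -c 1 2 4,
    (c 0 1 5 - c 0 3 6 + c 1 2 6 + c 2 3 5) / 2,
    (-c 0 1 4 + c 0 2 6 + c 1 3 6 + c 2 3 4) / 2,
    (-c 0 1 3 - c 0 5 6 + c 1 4 6 - c 3 4 5) / 2,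
    (c 0 1 2 + c 0 4 6 + c 1 5 6 - c 2 4 5) / 2,
    (-c 0 2 3 - c 0 4 5 - c 2 4 6 + c 3 5 6) / 2;
    (c 0 2 5 + c 0 3 4 + c 1 2 4 + c 1 3 5) / 2,
    (-2 * c 0 1 6 + c 0 2 4 - c 0 3 5 + 2 * c 1 2 5 + 2 * c 1 3 4 + c 2 3 6 + c 4 5 6) / 6,
    (c 0 1 4 - c 0 2 6 - c 1 3 6 + c 2 3 4) / 2,
    (c 0 1 5 - c 0 3 6 + c 1 2 6 - c 2 3 5) / 2,
    (-c 0 1 2 - c 0 4 6 - c 1 5 6 - c 2 4 5) / 2,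
    (-c 0 1 3 - c 0 5 6 + c 1 4 6 + c 3 4 5) / 2,
    (-c 1 2 3 - c 1 4 5 + c 2 5 6 + c 3 4 6) / 2;
    -c 0 1 5,
    -c 0 1 4,
    (c 0 1 6 - 2 * c 0 2 4 - c 0 3 5 + 2 * c 1 2 5 - c 1 3 4 - 2 * c 2 3 6 + c 4 5 6) / 6,
    (c 0 2 5 - c 0 3 4 + c 1 2 4 + c 1 3 5) / 2,
    (c 1 2 3 + c 1 4 5 - c 2 5 6 + c 3 4 6) / 2,
    (-c 0 2 3 + c 0 4 5 + c 2 4 6 + c 3 5 6) / 2,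
    (-c 0 1 2 + c 0 4 6 - c 1 5 6 - c 2 4 5) / 2;
    0,
    0,
    0,
    (c 0 1 6 + c 0 2 4 + 2 * c 0 3 5 - c 1 2 5 + 2 * c 1 3 4 - 2 * c 2 3 6 + c 4 5 6) / 6,
    (c 0 2 3 + c 0 4 5 - c 2 4 6 - c 3 5 6) / 2,
    (c 1 2 3 - c 1 4 5 - c 2 5 6 + c 3 4 6) / 2,
    (-c 0 1 3 - c 0 5 6 - c 1 4 6 - c 3 4 5) / 2;
    c 0 1 3,
    c 0 1 2,
    -c 1 2 3,
    -c 0 2 3,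
    (c 0 1 6 - 2 * c 0 2 4 - c 0 3 5 - c 1 2 5 + 2 * c 1 3 4 + c 2 3 6 - 2 * c 4 5 6) / 6,
    (-c 0 2 5 + c 0 3 4 + c 1 2 4 + c 1 3 5) / 2,
    (-c 0 1 4 - c 0 2 6 + c 1 3 6 - c 2 3 4) / 2;
    0,
    0,
    0,
    0,
    0,
    (c 0 1 6 + c 0 2 4 + 2 * c 0 3 5 + 2 * c 1 2 5 - c 1 3 4 + c 2 3 6 - 2 * c 4 5 6) / 6,
    (-c 0 1 5 + c 0 3 6 + c 1 2 6 - c 2 3 5) / 2;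
    0,
    0,
    0,
    0,
    0,
    0,
    (-2 * c 0 1 6 + c 0 2 4 - c 0 3 5 - c 1 2 5 - c 1 3 4 - 2 * c 2 3 6 - 2 * c 4 5 6) / 6]

theorem thetaPhi_preimage_basis (c : Fin 7 → Fin 7 → Fin 7 → ℝ) {i j k : Fin 7}
    (hij : i < j) (hjk : j < k) :
    thetaPhi (Matrix.toLin' (thetaPhiPreimage c))
      ![Pi.single i 1, Pi.single j 1, Pi.single k 1] = c i j k := by
  simp only [thetaPhi, AlternatingMap.coe_mk, MultilinearMap.coe_mk, phi3, wedge3,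
    Matrix.toLin'_apply, Matrix.mulVec_single_one, Matrix.cons_val, Matrix.col_apply]
  fin_cases i <;> fin_cases j <;> first | (exact absurd hij (by decide)) | skip
  all_goals fin_cases k <;> first | (exact absurd hjk (by decide)) | skip
  all_goals simp [thetaPhiPreimage] <;> ring

/-- The linear map `End(ℝ⁷) → Λ³(ℝ⁷)*`, `A ↦ θ(A)φ`, where
`(θ(A)φ)(x,y,z) = −φ(Ax,y,z) − φ(x,Ay,z) − φ(x,y,Az)`, is surjective: every alternating
3-form `ψ` on `ℝ⁷` equals `θ(A)φ` for some `A`. -/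
theorem stmt_19 (ψ : AlternatingMap ℝ (Fin 7 → ℝ) ℝ (Fin 3)) :
    ∃ A : Module.End ℝ (Fin 7 → ℝ), ∀ x y z : Fin 7 → ℝ,
      -phi3 (A x) y z - phi3 x (A y) z - phi3 x y (A z) = ψ ![x, y, z] := by
  let c i j k : ℝ := ψ ![Pi.single i 1, Pi.single j 1, Pi.single k 1]
  have key : thetaPhi (Matrix.toLin' (thetaPhiPreimage c)) = ψ := by
    refine AlternatingMap.ext_basis_strictMono (Pi.basisFun ℝ (Fin 7)) fun v hv => ?_
    have hb : Pi.basisFun ℝ (Fin 7) ∘ v =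
        ![Pi.single (v 0) 1, Pi.single (v 1) 1, Pi.single (v 2) 1] := by
      ext m : 1
      fin_cases m <;> simp
    rw [hb]
    exact thetaPhi_preimage_basis c (hv (by decide)) (hv (by decide))
  exact ⟨_, fun x y z => DFunLike.congr_fun key ![x, y, z]⟩
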